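/- Let n, m be positive integers with m < n. Let E ⊆ ℝⁿ be an m-rectifiable set (ℋᵐ-measurable, ℋᵐ(E) > 0, covered up to an ℋᵐ-null set by countably many C¹ embeddings of ℝᵐ into ℝⁿ) which is not m-flat, i.e., E is not contained in any affine m-plane. Then the set of directions 𝒟(E) = {(y − x)/|y − x| : x, y ∈ E, y ≠ x} ⊆ S^{n−1} has positive ℋᵐ measure. -/

import Mathlib

open MeasureTheory Metric Set
open scoped ENNReal

/-- The radial projection from `x`, mapping `y ≠ x` to `(y - x)/‖y - x‖ ∈ S^{n-1}`. -/
noncomputable def radialProj {n : ℕ} (x y : EuclideanSpace ℝ (Fin n)) : EuclideanSpace ℝ (Fin n) :=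
  ‖y - x‖⁻¹ • (y - x)

/-- A `C¹` embedding: continuously differentiable and a homeomorphism onto its image. -/
def IsC1Embedding {m n : ℕ} (f : EuclideanSpace ℝ (Fin m) → EuclideanSpace ℝ (Fin n)) : Prop :=
  ContDiff ℝ 1 f ∧ Topology.IsEmbedding f

/-- `T` is an affine `k`-plane: a translate of a `k`-dimensional linear subspace. -/
def IsAffinePlane {n : ℕ} (k : ℕ) (T : Set (EuclideanSpace ℝ (Fin n))) : Prop :=
  ∃ (W : Submodule ℝ (EuclideanSpace ℝ (Fin n))) (v : EuclideanSpace ℝ (Fin n)),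
    Module.finrank ℝ W = k ∧ T = (fun w => v + w) '' (W : Set (EuclideanSpace ℝ (Fin n)))

/-- `E` is `m`-rectifiable: `ℋᵐ`-measurable, of positive `ℋᵐ` measure, and covered up to an
`ℋᵐ`-null set by countably many `C¹` embeddings of `ℝᵐ` into `ℝⁿ`. -/
def IsRectifiableSet (m n : ℕ) (E : Set (EuclideanSpace ℝ (Fin n))) : Prop :=
  NullMeasurableSet E (μH[(m : ℝ)]) ∧ 0 < μH[(m : ℝ)] E ∧
  ∃ f : ℕ → (EuclideanSpace ℝ (Fin m) → EuclideanSpace ℝ (Fin n)),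
    (∀ i, IsC1Embedding (f i)) ∧ μH[(m : ℝ)] (E \ ⋃ i, Set.range (f i)) = 0

open scoped NNReal Topology
open Module

theorem hausdorffMeasure_image_le_of_dist_le {X Y Z : Type*} [MetricSpace Y] [MetricSpace Z]
    [MeasurableSpace Y] [BorelSpace Y] [MeasurableSpace Z] [BorelSpace Z] {d : ℝ} (hd : 0 ≤ d)
    {f : X → Y} {g : X → Z} {s : Set X} {C : ℝ≥0}
    (h : ∀ a ∈ s, ∀ b ∈ s, dist (f a) (f b) ≤ C * dist (g a) (g b)) :
    μH[d] (f '' s) ≤ (C : ℝ≥0∞) ^ d * μH[d] (g '' s) := by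
  rcases s.eq_empty_or_nonempty with rfl | ⟨a₀, ha₀⟩
  · simp
  have : Nonempty X := ⟨a₀⟩
  have hi : ∀ a ∈ s, Function.invFunOn g s (g a) ∈ s ∧ g (Function.invFunOn g s (g a)) = g a :=
    fun a ha => Function.invFunOn_pos ⟨a, ha, rfl⟩
  have himage : f '' s = (f ∘ Function.invFunOn g s) '' (g '' s) := by
    rw [image_image]
    refine image_congr fun a ha => ?_
    have := h a ha _ (hi a ha).1
    rw [(hi a ha).2, dist_self, mul_zero] at this
    exact dist_le_zero.1 this
  rw [himage]
  refine LipschitzOnWith.hausdorffMeasure_image_le (LipschitzOnWith.of_dist_le_mul ?_) hd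
  rintro _ ⟨a, ha, rfl⟩ _ ⟨b, hb, rfl⟩
  simpa only [Function.comp_apply, (hi a ha).2, (hi b hb).2] using
    h _ (hi a ha).1 _ (hi b hb).1

section HausdorffImage

variable {V F : Type*} [NormedAddCommGroup V] [InnerProductSpace ℝ V] [FiniteDimensional ℝ V]
  [MeasurableSpace V] [BorelSpace V] [NormedAddCommGroup F] [NormedSpace ℝ F]
  [MeasurableSpace F] [BorelSpace F]

theorem exists_hausdorffMeasure_image_le_of_approximatesLinearOn {A : V →L[ℝ] F}
    (hA : ¬ Function.Injective A) {ε : ℝ≥0∞} (hε : 0 < ε) :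
    ∃ r : ℝ≥0, r ≠ 0 ∧ ∀ (f : V → F) (s : Set V), ApproximatesLinearOn f A s r →
      μH[(finrank ℝ V : ℝ)] (f '' s) ≤ ε * μH[(finrank ℝ V : ℝ)] s := by
  set K : Submodule ℝ V := LinearMap.ker (A : V →ₗ[ℝ] F) with hK
  set P : V →L[ℝ] V := Kᗮ.starProjection with hP
  set C : ℝ≥0 := ‖A‖₊ + 1
  set d : ℝ := (finrank ℝ V : ℝ)
  have hd : 0 ≤ d := Nat.cast_nonneg _
  let S : ℝ → V →L[ℝ] V := fun δ => P + δ • ContinuousLinearMap.id ℝ V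
  have hAP : ∀ u, A u = A (P u) := fun u => by
    have h : u - P u ∈ K := by
      have := Kᗮ.sub_starProjection_mem_orthogonal u
      rwa [Submodule.orthogonal_orthogonal] at this
    have h2 : A (u - P u) = 0 := h
    rwa [map_sub, sub_eq_zero] at h2
  have hdet : (S 0).det = 0 := by
    by_contra hne
    apply hA
    intro u v huv
    have hmem : u - v ∈ K := by
      rw [hK, LinearMap.mem_ker]
      simp [huv]
    have hPz : S 0 (u - v) = 0 := by
      simp only [S, zero_smul, add_zero, hP]
      rw [Submodule.starProjection_apply_eq_zero_iff, Submodule.orthogonal_orthogonal]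
      exact hmem
    have hinj : Function.Injective (S 0 : V →ₗ[ℝ] V) :=
      ((S 0 : V →ₗ[ℝ] V).equivOfDetNeZero hne).injective
    exact sub_eq_zero.1 (hinj (hPz.trans (map_zero _).symm))
  have hcont : Filter.Tendsto
      (fun δ : ℝ => (C : ℝ≥0∞) ^ d * ENNReal.ofReal |(S δ).det|) (𝓝[>] 0) (𝓝 0) := by
    have h1 : Continuous fun δ : ℝ => (C : ℝ≥0∞) ^ d * ENNReal.ofReal |(S δ).det| := by
      refine (ENNReal.continuous_const_mul ?_).comp (ENNReal.continuous_ofReal.comp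
        (continuous_abs.comp (ContinuousLinearMap.continuous_det.comp ?_)))
      · exact ENNReal.rpow_ne_top_of_nonneg hd ENNReal.coe_ne_top
      · fun_prop
    have h2 := h1.tendsto 0
    simp only [hdet, abs_zero, ENNReal.ofReal_zero, mul_zero] at h2
    exact h2.mono_left nhdsWithin_le_nhds
  obtain ⟨δ, hδ, hδ0⟩ := ((hcont.eventually (gt_mem_nhds hε)).and self_mem_nhdsWithin).exists
  replace hδ0 : 0 < δ := hδ0
  refine ⟨δ.toNNReal, by simpa using hδ0, fun f s hf => ?_⟩
  have key : ∀ u, ‖P u‖ ≤ ‖S δ u‖ ∧ δ * ‖u‖ ≤ ‖S δ u‖ := by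
    intro u
    have hin : inner ℝ (P u) u = ‖P u‖ ^ 2 := by
      have h0 : inner ℝ (P u) (u - P u) = 0 :=
        Kᗮ.sub_starProjection_mem_orthogonal u _ (Kᗮ.starProjection_apply_mem u)
      rw [inner_sub_right, real_inner_self_eq_norm_sq] at h0
      linarith
    have hS : ‖S δ u‖ ^ 2 = ‖P u‖ ^ 2 + 2 * δ * ‖P u‖ ^ 2 + (δ * ‖u‖) ^ 2 := by
      have : S δ u = P u + δ • u := rfl
      rw [this, norm_add_sq_real, inner_smul_right, hin, norm_smul, Real.norm_of_nonneg hδ0.le]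
      ring
    have hnn : 0 ≤ δ * ‖P u‖ ^ 2 := by positivity
    constructor
    · exact le_of_sq_le_sq (by nlinarith [sq_nonneg (δ * ‖u‖)]) (norm_nonneg _)
    · exact le_of_sq_le_sq (by nlinarith [sq_nonneg ‖P u‖]) (norm_nonneg _)
  have hbound : ∀ a ∈ s, ∀ b ∈ s, dist (f a) (f b) ≤ C * dist (S δ a) (S δ b) := by
    intro a ha b hb
    obtain ⟨h1, h2⟩ := key (a - b)
    have h3 := hf a ha b hb
    rw [Real.coe_toNNReal _ hδ0.le] at h3
    rw [dist_eq_norm, dist_eq_norm, ← map_sub]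
    calc ‖f a - f b‖ = ‖A (P (a - b)) + (f a - f b - A (a - b))‖ := by rw [← hAP]; abel_nf
      _ ≤ ‖A (P (a - b))‖ + ‖f a - f b - A (a - b)‖ := norm_add_le _ _
      _ ≤ ‖A‖ * ‖S δ (a - b)‖ + ‖S δ (a - b)‖ :=
        add_le_add ((A.le_opNorm _).trans (by gcongr)) (h3.trans h2)
      _ = C * ‖S δ (a - b)‖ := by simp only [C]; push_cast; ring
  calc μH[d] (f '' s) ≤ (C : ℝ≥0∞) ^ d * μH[d] (S δ '' s) :=
        hausdorffMeasure_image_le_of_dist_le hd hbound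
    _ = (C : ℝ≥0∞) ^ d * ENNReal.ofReal |(S δ).det| * μH[d] s := by
      rw [Measure.addHaar_image_continuousLinearMap, mul_assoc]
    _ ≤ ε * μH[d] s := by gcongr

variable [SecondCountableTopology F]

/-- The image of the critical set of a differentiable map has zero Hausdorff measure in the
dimension of the source. -/
theorem hausdorffMeasure_image_eq_zero_of_not_injective {f : V → F} {s : Set V}
    {f' : V → V →L[ℝ] F} (hf' : ∀ x ∈ s, HasFDerivWithinAt f (f' x) s x)
    (hinj : ∀ x ∈ s, ¬ Function.Injective (f' x)) :
    μH[(finrank ℝ V : ℝ)] (f '' s) = 0 := by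
  wlog hs : μH[(finrank ℝ V : ℝ)] s ≠ ∞ generalizing s
  · have hcov : f '' s ⊆ ⋃ n : ℕ, f '' (s ∩ closedBall 0 n) := by
      rw [← image_iUnion, ← inter_iUnion, iUnion_closedBall_nat, inter_univ]
    refine measure_mono_null hcov (measure_iUnion_null fun n => this
      (fun x hx => (hf' x hx.1).mono inter_subset_left) (fun x hx => hinj x hx.1) ?_)
    exact ((measure_mono inter_subset_right).trans_lt
      (isCompact_closedBall (0 : V) n).measure_lt_top).ne
  rcases s.eq_empty_or_nonempty with rfl | hne
  · simp
  have hbound : ∀ ε : ℝ≥0, 0 < ε →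
      μH[(finrank ℝ V : ℝ)] (f '' s) ≤ ε * μH[(finrank ℝ V : ℝ)] s := by
    intro ε hε
    have hr : ∀ A : V →L[ℝ] F, ∃ r : ℝ≥0, r ≠ 0 ∧ (¬ Function.Injective A →
        ∀ (f : V → F) (s : Set V), ApproximatesLinearOn f A s r →
          μH[(finrank ℝ V : ℝ)] (f '' s) ≤ ε * μH[(finrank ℝ V : ℝ)] s) := by
      intro A
      by_cases hA : Function.Injective A
      · exact ⟨1, one_ne_zero, fun h => absurd hA h⟩
      · obtain ⟨r, hr, h⟩ := exists_hausdorffMeasure_image_le_of_approximatesLinearOn hA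
          (ENNReal.coe_pos.2 hε)
        exact ⟨r, hr, fun _ => h⟩
    choose r hr0 hr using hr
    obtain ⟨t, A, htd, htm, hst, happ, hA⟩ :=
      exists_partition_approximatesLinearOn_of_hasFDerivWithinAt f s f' hf' r hr0
    have hAinj : ∀ n, ¬ Function.Injective (A n) := fun n => by
      obtain ⟨y, hy, h⟩ := hA hne n
      rw [h]
      exact hinj y hy
    calc μH[(finrank ℝ V : ℝ)] (f '' s)
        ≤ μH[(finrank ℝ V : ℝ)] (⋃ n, f '' (s ∩ t n)) := by
          rw [← image_iUnion, ← inter_iUnion, inter_eq_left.2 hst]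
      _ ≤ ∑' n, μH[(finrank ℝ V : ℝ)] (f '' (s ∩ t n)) := measure_iUnion_le _
      _ ≤ ∑' n, ε * μH[(finrank ℝ V : ℝ)] (s ∩ t n) :=
          ENNReal.tsum_le_tsum fun n => hr (A n) (hAinj n) f _ (happ n)
      _ = ε * ∑' n, (μH[(finrank ℝ V : ℝ)]).restrict s (t n) := by
          rw [ENNReal.tsum_mul_left]
          simp_rw [Measure.restrict_apply (htm _), inter_comm]
      _ ≤ ε * μH[(finrank ℝ V : ℝ)] s := by
          rw [← measure_iUnion htd htm]
          refine mul_le_mul_right ?_ _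
          exact (measure_mono (subset_univ _)).trans_eq (Measure.restrict_apply_univ s)
  refine le_antisymm (le_of_forall_gt fun c hc => ?_) zero_le
  obtain ⟨ε, hε, hlt⟩ := ENNReal.exists_nnreal_pos_mul_lt hs hc.ne'
  exact (hbound ε hε).trans_lt hlt

/-- Differentiable maps send null sets to null sets, for Hausdorff measures. -/
theorem hausdorffMeasure_image_eq_zero_of_hasFDerivWithinAt {d : ℝ} (hd : 0 ≤ d) {f : V → F}
    {s : Set V} {f' : V → V →L[ℝ] F} (hf' : ∀ x ∈ s, HasFDerivWithinAt f (f' x) s x)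
    (hs : μH[d] s = 0) : μH[d] (f '' s) = 0 := by
  obtain ⟨t, A, -, -, hst, happ, -⟩ :=
    exists_partition_approximatesLinearOn_of_hasFDerivWithinAt f s f' hf' (fun _ => 1)
      fun _ => one_ne_zero
  rw [← inter_eq_left.2 hst, inter_iUnion, image_iUnion]
  refine measure_iUnion_null fun n => le_antisymm ?_ zero_le
  have hlip : LipschitzOnWith (‖A n‖₊ + 1) f (s ∩ t n) :=
    lipschitzOnWith_iff_restrict.2 (happ n).lipschitz
  refine (hlip.hausdorffMeasure_image_le hd).trans_eq ?_
  rw [measure_mono_null inter_subset_left hs, mul_zero]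

/-- A set mapped to a null set by a map with injective derivative is null, for Hausdorff
measures. -/
theorem hausdorffMeasure_eq_zero_of_image_of_injective {d : ℝ} (hd : 0 ≤ d) {f : V → F}
    {s : Set V} {f' : V → V →L[ℝ] F} (hf' : ∀ x ∈ s, HasFDerivWithinAt f (f' x) s x)
    (hinj : ∀ x ∈ s, Function.Injective (f' x)) (hs : μH[d] (f '' s) = 0) : μH[d] s = 0 := by
  rcases s.eq_empty_or_nonempty with rfl | hne
  · simp
  have hr : ∀ A : V →L[ℝ] F, ∃ r : ℝ≥0, r ≠ 0 ∧
      (Function.Injective A → ∀ u, 2 * r * ‖u‖ ≤ ‖A u‖) := by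
    intro A
    by_cases hA : Function.Injective A
    · obtain ⟨K, hK, h⟩ := (A : V →ₗ[ℝ] F).injective_iff_antilipschitz.1 hA
      refine ⟨(2 * K)⁻¹, by positivity, fun _ u => ?_⟩
      have h1 : ‖u‖ ≤ K * ‖A u‖ := by simpa using h.le_mul_dist u 0
      have hK' : (0 : ℝ) < K := hK
      push_cast
      calc 2 * (2 * (K : ℝ))⁻¹ * ‖u‖ = (K : ℝ)⁻¹ * ‖u‖ := by field_simp
        _ ≤ (K : ℝ)⁻¹ * (K * ‖A u‖) := by gcongr
        _ = ‖A u‖ := by field_simp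
    · exact ⟨1, one_ne_zero, fun h => absurd h hA⟩
  choose r hr0 hr using hr
  obtain ⟨t, A, -, -, hst, happ, hA⟩ :=
    exists_partition_approximatesLinearOn_of_hasFDerivWithinAt f s f' hf' r hr0
  rw [← inter_eq_left.2 hst, inter_iUnion]
  refine measure_iUnion_null fun n => le_antisymm ?_ zero_le
  have hAinj : Function.Injective (A n) := by
    obtain ⟨y, hy, h⟩ := hA hne n
    rw [h]
    exact hinj y hy
  have hbound : ∀ a ∈ s ∩ t n, ∀ b ∈ s ∩ t n,
      dist (id a) (id b) ≤ ((r (A n))⁻¹ : ℝ≥0) * dist (f a) (f b) := by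
    intro a ha b hb
    have h1 := hr (A n) hAinj (a - b)
    have h2 := happ n a ha b hb
    have h3 : ‖A n (a - b)‖ ≤ ‖f a - f b‖ + ‖f a - f b - A n (a - b)‖ := by
      simpa using norm_sub_le (f a - f b) (f a - f b - A n (a - b))
    have hpos : (0 : ℝ) < r (A n) := NNReal.coe_pos.2 (pos_iff_ne_zero.2 (hr0 _))
    rw [NNReal.coe_inv, le_inv_mul_iff₀ hpos, id, id, dist_eq_norm, dist_eq_norm]
    linarith
  have := hausdorffMeasure_image_le_of_dist_le hd hbound
  rw [image_id] at this
  refine this.trans_eq ?_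
  rw [measure_mono_null (image_mono inter_subset_left) hs, mul_zero]

end HausdorffImage

theorem exists_hasFDerivAt_radialProj_comp_injective {V : Type*} [NormedAddCommGroup V]
    [NormedSpace ℝ V] {n : ℕ} {f : V → EuclideanSpace ℝ (Fin n)}
    {A : V →L[ℝ] EuclideanSpace ℝ (Fin n)} {a : V} {x : EuclideanSpace ℝ (Fin n)}
    (hf : HasFDerivAt f A a) (hA : Function.Injective A) (hx : f a - x ∉ range A) :
    ∃ B : V →L[ℝ] EuclideanSpace ℝ (Fin n),
      HasFDerivAt (fun b => radialProj x (f b)) B a ∧ Function.Injective B := by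
  have hne : f a - x ≠ 0 := fun h => hx ⟨0, by rw [map_zero, h]⟩
  have hsub : HasFDerivAt (fun b => f b - x) A a := hf.sub_const x
  have hc : DifferentiableAt ℝ (fun b => ‖f b - x‖⁻¹) a :=
    (hsub.differentiableAt.norm ℝ hne).inv (norm_ne_zero_iff.2 hne)
  refine ⟨_, hc.hasFDerivAt.fun_smul hsub, ?_⟩
  rw [injective_iff_map_eq_zero]
  intro u hu
  simp only [add_apply, smul_apply,
    ContinuousLinearMap.smulRight_apply] at hu
  set c : ℝ := fderiv ℝ (fun b => ‖f b - x‖⁻¹) a u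
  by_cases hc0 : c = 0
  · rw [hc0, zero_smul, add_zero, smul_eq_zero, inv_eq_zero, norm_eq_zero] at hu
    exact (injective_iff_map_eq_zero A).1 hA u (hu.resolve_left hne)
  · refine absurd ⟨-(c⁻¹ * ‖f a - x‖⁻¹) • u, ?_⟩ hx
    rw [map_smul, neg_smul, mul_smul, eq_neg_of_add_eq_zero_left hu, smul_neg, neg_neg,
      smul_smul, inv_mul_cancel₀ hc0, one_smul]

/-- If `E ⊆ ℝⁿ` is `m`-rectifiable and not contained in any affine `m`-plane, then the set of
directions `𝒟(E) = {(y − x)/‖y − x‖ : x, y ∈ E, y ≠ x}` has positive `ℋᵐ` measure. -/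
theorem stmt8 {n m : ℕ} (hm : 0 < m) (hmn : m < n)
    (E : Set (EuclideanSpace ℝ (Fin n)))
    (hE : IsRectifiableSet m n E)
    (hflat : ¬ ∃ T : Set (EuclideanSpace ℝ (Fin n)), IsAffinePlane m T ∧ E ⊆ T) :
    0 < μH[(m : ℝ)]
      {d : EuclideanSpace ℝ (Fin n) | ∃ x ∈ E, ∃ y ∈ E, y ≠ x ∧ d = radialProj x y} := by
  have hm0 : (0 : ℝ) ≤ m := Nat.cast_nonneg m
  rw [pos_iff_ne_zero]
  intro hD
  obtain ⟨-, hpos, f, hf, hcov⟩ := hE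
  have hdiff : ∀ i a, HasFDerivAt (f i) (fderiv ℝ (f i) a) a := fun i a =>
    ((hf i).1.differentiable one_ne_zero a).hasFDerivAt
  obtain ⟨Q, hQE, hQc, hQd⟩ :=
    (TopologicalSpace.IsSeparable.of_separableSpace E).exists_countable_dense_subset
  set N : ℕ → Set (EuclideanSpace ℝ (Fin m)) := fun i =>
    {a | ¬ Function.Injective (fderiv ℝ (f i) a)}
  set B : ℕ → EuclideanSpace ℝ (Fin n) → Set (EuclideanSpace ℝ (Fin m)) := fun i x =>
    {a | f i a ∈ E ∧ Function.Injective (fderiv ℝ (f i) a) ∧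
      f i a - x ∉ range (fderiv ℝ (f i) a)}
  have hNnull : ∀ i, μH[(m : ℝ)] (f i '' N i) = 0 := fun i => by
    have := hausdorffMeasure_image_eq_zero_of_not_injective (f := f i) (s := N i)
      (fun a _ => (hdiff i a).hasFDerivWithinAt) (fun a ha => ha)
    rwa [finrank_euclideanSpace_fin] at this
  have hBnull : ∀ i, ∀ x ∈ E, μH[(m : ℝ)] (f i '' B i x) = 0 := by
    intro i x hx
    refine hausdorffMeasure_image_eq_zero_of_hasFDerivWithinAt hm0
      (fun a _ => (hdiff i a).hasFDerivWithinAt) ?_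
    have hg : ∀ a, ∃ G : EuclideanSpace ℝ (Fin m) →L[ℝ] EuclideanSpace ℝ (Fin n), a ∈ B i x →
        HasFDerivAt (fun b => radialProj x (f i b)) G a ∧ Function.Injective G := fun a => by
      by_cases ha : a ∈ B i x
      · obtain ⟨G, hG⟩ := exists_hasFDerivAt_radialProj_comp_injective (hdiff i a) ha.2.1 ha.2.2
        exact ⟨G, fun _ => hG⟩
      · exact ⟨0, fun h => absurd h ha⟩
    choose G hG using hg
    refine hausdorffMeasure_eq_zero_of_image_of_injective hm0
      (fun a ha => (hG a ha).1.hasFDerivWithinAt) (fun a ha => (hG a ha).2)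
      (measure_mono_null ?_ hD)
    rintro _ ⟨a, ha, rfl⟩
    refine ⟨x, hx, f i a, ha.1, fun h => ha.2.2 ⟨0, ?_⟩, rfl⟩
    rw [map_zero, h, sub_self]
  have hnull : μH[(m : ℝ)] ((E \ ⋃ i, range (f i)) ∪
      ⋃ i, (f i '' N i ∪ ⋃ x ∈ Q, f i '' B i x)) = 0 :=
    measure_union_null hcov (measure_iUnion_null fun i => measure_union_null (hNnull i)
      ((measure_biUnion_null_iff hQc).2 fun x hx => hBnull i x (hQE hx)))
  obtain ⟨y, hyE, hy⟩ : ∃ y ∈ E, y ∉ (E \ ⋃ i, range (f i)) ∪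
      ⋃ i, (f i '' N i ∪ ⋃ x ∈ Q, f i '' B i x) := by
    by_contra! h
    exact hpos.ne' (measure_mono_null h hnull)
  simp only [mem_union, not_or, mem_sdiff, not_and, not_not] at hy
  obtain ⟨i, a, rfl⟩ := mem_iUnion.1 (hy.1 hyE)
  simp only [mem_iUnion, mem_union, not_or, not_exists] at hy
  have hinj : Function.Injective (fderiv ℝ (f i) a) := by
    by_contra h
    exact (hy.2 i).1 ⟨a, h, rfl⟩
  set W : Submodule ℝ (EuclideanSpace ℝ (Fin n)) :=
    LinearMap.range (fderiv ℝ (f i) a : EuclideanSpace ℝ (Fin m) →ₗ[ℝ] EuclideanSpace ℝ (Fin n))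
  have hQW : Q ⊆ {x | f i a - x ∈ W} := fun x hx => by
    by_contra h
    exact (hy.2 i).2 x hx ⟨a, ⟨hyE, hinj, h⟩, rfl⟩
  have hclosed : IsClosed {x | f i a - x ∈ W} :=
    W.closed_of_finiteDimensional.preimage (continuous_const.sub continuous_id)
  refine hflat ⟨_, ⟨W, f i a, ?_, rfl⟩, fun x hx => ?_⟩
  · rw [LinearMap.finrank_range_of_inj hinj, finrank_euclideanSpace_fin]
  · have hxW : f i a - x ∈ W := closure_minimal hQW hclosed (hQd hx)
    exact ⟨x - f i a, by rw [← neg_sub]; exact W.neg_mem hxW, by simp⟩
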